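/- arXiv:2010.04961 — 9 statements merged into one kernel-verified Lean document; each statement's English description precedes it below -/
import Mathlib

section
/- Let S be a semilattice, X a topological space, and θ : S → O(X) a spatial representation, i.e. θ maps into the open sets of X, the sets θ(a) for a ∈ S cover X, and θ(ab) = θ(a) ∩ θ(b) for all a, b ∈ S. Then there exists a unique continuous map φ : X → F(S) such that θ(a) = φ⁻¹[F_a] for all a ∈ S. -/
variable {S : Type*}

/-- A filter of a semilattice: `a, b ∈ F ↔ ab ∈ F`. -/
def IsSLFilter [Semigroup S] (F : Set S) : Prop :=
  ∀ a b : S, (a ∈ F ∧ b ∈ F) ↔ a * b ∈ F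

/-- The filter spectrum: nonempty filters. -/
def FilterSpectrum (S : Type*) [Semigroup S] : Type _ :=
  {F : Set S // IsSLFilter F ∧ F.Nonempty}

/-- The filter representation `a ↦ F_a`. -/
def filterRep [Semigroup S] (a : S) : Set (FilterSpectrum S) :=
  {F | a ∈ F.1}

/-- The topology on the filter spectrum generated by the sets `F_a`. -/
instance [Semigroup S] : TopologicalSpace (FilterSpectrum S) :=
  TopologicalSpace.generateFrom (Set.range (filterRep (S := S)))

theorem stmt1 [CommSemigroup S] (hidem : ∀ a : S, a * a = a)
    {X : Type*} [TopologicalSpace X] (θ : S → Set X)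
    (hopen : ∀ a : S, IsOpen (θ a))
    (hcover : ∀ x : X, ∃ a : S, x ∈ θ a)
    (hmul : ∀ a b : S, θ (a * b) = θ a ∩ θ b) :
    ∃! φ : X → FilterSpectrum S,
      Continuous φ ∧ ∀ a : S, θ a = φ ⁻¹' filterRep a := by
  refine ⟨fun x => ⟨{a | x ∈ θ a}, fun a b => ?_, hcover x⟩, ⟨?_, fun a => rfl⟩, ?_⟩
  · simp only [Set.mem_ofPred_eq, hmul, Set.mem_inter_iff]
  · refine continuous_generateFrom_iff.2 ?_
    rintro _ ⟨a, rfl⟩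
    exact hopen a
  · rintro ψ ⟨-, hψ⟩
    funext x
    refine Subtype.ext (Set.ext fun a => ?_)
    change x ∈ ψ ⁻¹' filterRep a ↔ x ∈ θ a
    rw [hψ a]
end

section
/- In a structured semigroup (S, N, Z), for all a, b, s ∈ S the following are equivalent: (i) a <_s b; (ii) asb = a, as ∈ N, bs ∈ Z and sb ∈ Z; (iii) bsa = a, sa ∈ N, bs ∈ Z and sb ∈ Z. -/
open Pointwise

variable {S : Type*}

/-- `a <_s b`: the domination relation via `s`. -/
def domBy [Semigroup S] (N Z : Set S) (a s b : S) : Prop :=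
  a * s * b = a ∧ b * s * a = a ∧ a * s ∈ N ∧ s * a ∈ N ∧ b * s ∈ Z ∧ s * b ∈ Z

/-- `a < b`: domination. -/
def domRel [Semigroup S] (N Z : Set S) (a b : S) : Prop := ∃ s, domBy N Z a s b

/-- The up-closure `A^<`. -/
def upClo [Semigroup S] (N Z : Set S) (A : Set S) : Set S :=
  {b | ∃ a ∈ A, domRel N Z a b}

/-- The dual `A^*`. -/
def dualSet [Semigroup S] (N Z : Set S) (A : Set S) : Set S :=
  {s | ∃ a ∈ A, ∃ b, domBy N Z a s b}

/-- Structured semigroup data on `(S, N, Z)`. -/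
structure Structured [Semigroup S] (N Z : Set S) : Prop where
  nMul : ∀ m ∈ N, ∀ n ∈ N, m * n ∈ N
  zMul : ∀ y ∈ Z, ∀ z ∈ Z, y * z ∈ Z
  zSubN : Z ⊆ N
  zComm : ∀ z ∈ Z, ∀ n ∈ N, z * n = n * z
  binormal : ∀ a b : S, a * b ∈ Z → b * a ∈ Z → ∀ z ∈ Z, a * z * b ∈ Z ∧ b * z * a ∈ Z
  trinormal : ∀ a b : S, ∀ n ∈ N, a * b * n = n → n * a * b = n →
    a * b ∈ Z → b * a ∈ Z → b * n * a ∈ N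

/-- An atlas: `A A^* A ⊆ A ⊆ A^<`. -/
def IsAtlas [Semigroup S] (N Z : Set S) (A : Set S) : Prop :=
  A * dualSet N Z A * A ⊆ A ∧ A ⊆ upClo N Z A

/-- A coset: `A A^* A ⊆ A = A^<`. -/
def IsCoset [Semigroup S] (N Z : Set S) (A : Set S) : Prop :=
  A * dualSet N Z A * A ⊆ A ∧ upClo N Z A = A

/-- Source `s(A) = (A^* A)^<`. -/
def srcSet [Semigroup S] (N Z : Set S) (A : Set S) : Set S :=
  upClo N Z (dualSet N Z A * A)

/-- Range `r(A) = (A A^*)^<`. -/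
def rngSet [Semigroup S] (N Z : Set S) (A : Set S) : Set S :=
  upClo N Z (A * dualSet N Z A)

/-- `A|b`: `b` acts on `A` from the right. -/
def actsR [Semigroup S] (Z : Set S) (A : Set S) (b : S) : Prop :=
  ∃ b', b * b' ∈ Z ∧ b' * b ∈ Z ∧ ∃ a ∈ A, a * b * b' = a

/-- `b|A`: `b` acts on `A` from the left. -/
def actsL [Semigroup S] (Z : Set S) (b : S) (A : Set S) : Prop :=
  ∃ b', b * b' ∈ Z ∧ b' * b ∈ Z ∧ ∃ a ∈ A, b' * b * a = a

/-- `A^Z = {z ∈ Z : az = a for some a ∈ A}`. -/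
def AZset [Semigroup S] (Z : Set S) (A : Set S) : Set S :=
  {z ∈ Z | ∃ a ∈ A, a * z = a}

/-- `^Z A = {z ∈ Z : za = a for some a ∈ A}`. -/
def ZAset [Semigroup S] (Z : Set S) (A : Set S) : Set S :=
  {z ∈ Z | ∃ a ∈ A, z * a = a}

/-- The equivalence relation `a ~_A b`. -/
def eqvA [Semigroup S] (N Z : Set S) (A : Set S) (a b : S) : Prop :=
  ∃ s ∈ dualSet N Z A, ∃ t ∈ dualSet N Z A, s * a * t = s * b * t

/-- `Y` is symmetric: `ab ∈ Y → baba ∈ Y`. -/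
def IsSymmetric [Semigroup S] (Y : Set S) : Prop :=
  ∀ a b : S, a * b ∈ Y → b * a * b * a ∈ Y

/-- `D` is diagonal: `ad, d, db ∈ D → adb ∈ D`. -/
def IsDiagonal [Semigroup S] (D : Set S) : Prop :=
  ∀ a d b : S, a * d ∈ D → d ∈ D → d * b ∈ D → a * d * b ∈ D

theorem domBy_of_mul_right_eq [Semigroup S] {N Z : Set S} (h : Structured N Z) {a s b : S}
    (hasb : a * s * b = a) (has : a * s ∈ N) (hbs : b * s ∈ Z) (hsb : s * b ∈ Z) :
    domBy N Z a s b := by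
  have hr : a * s * (b * s) = a * s := by rw [← mul_assoc, hasb]
  have hl : b * s * (a * s) = a * s := by rw [h.zComm _ hbs _ has, hr]
  have hbsa : b * s * a = a := by
    calc b * s * a = b * s * (a * s) * b := by rw [mul_assoc (b * s), hasb]
      _ = a := by rw [hl, hasb]
  have hsa := h.trinormal b s (a * s) has hl (by rw [mul_assoc, hr]) hbs hsb
  rw [mul_assoc, hasb] at hsa
  exact ⟨hasb, hbsa, has, hsa, hbs, hsb⟩

theorem domBy_of_mul_left_eq [Semigroup S] {N Z : Set S} (h : Structured N Z) {a s b : S}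
    (hbsa : b * s * a = a) (hsa : s * a ∈ N) (hbs : b * s ∈ Z) (hsb : s * b ∈ Z) :
    domBy N Z a s b := by
  have hl : s * b * (s * a) = s * a := by rw [mul_assoc, ← mul_assoc b, hbsa]
  have hr : s * a * (s * b) = s * a := by rw [← h.zComm _ hsb _ hsa, hl]
  have hasb : a * s * b = a := by
    calc a * s * b = b * s * a * s * b := by rw [hbsa]
      _ = b * (s * a * (s * b)) := by simp only [mul_assoc]
      _ = a := by rw [hr, ← mul_assoc, hbsa]
  have has := h.trinormal s b (s * a) hsa hl (by rw [mul_assoc, hr]) hsb hbs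
  rw [← mul_assoc, hbsa] at has
  exact ⟨hasb, hbsa, has, hsa, hbs, hsb⟩

theorem stmt4 [Semigroup S] (N Z : Set S) (h : Structured N Z) (a s b : S) :
    (domBy N Z a s b ↔ (a * s * b = a ∧ a * s ∈ N ∧ b * s ∈ Z ∧ s * b ∈ Z)) ∧
    (domBy N Z a s b ↔ (b * s * a = a ∧ s * a ∈ N ∧ b * s ∈ Z ∧ s * b ∈ Z)) := by
  refine ⟨⟨?_, ?_⟩, ⟨?_, ?_⟩⟩
  · rintro ⟨hasb, -, has, -, hbs, hsb⟩
    exact ⟨hasb, has, hbs, hsb⟩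
  · rintro ⟨hasb, has, hbs, hsb⟩
    exact domBy_of_mul_right_eq h hasb has hbs hsb
  · rintro ⟨-, hbsa, -, hsa, hbs, hsb⟩
    exact ⟨hbsa, hsa, hbs, hsb⟩
  · rintro ⟨hbsa, hsa, hbs, hsb⟩
    exact domBy_of_mul_left_eq h hbsa hsa hbs hsb
end

section
/- In a structured semigroup (S, N, Z), the domination relation is transitive in the following strong sense: for all a, b, b', c, c' ∈ S, if a <_{b'} b and b <_{c'} c then a <_{c'} c. -/
open Pointwise

variable {S : Type*}

theorem stmt5 [Semigroup S] (N Z : Set S) (h : Structured N Z) (a b b' c c' : S)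
    (h1 : domBy N Z a b' b) (h2 : domBy N Z b c' c) :
    domBy N Z a c' c := by
  obtain ⟨hab, hba, hN, hN', -, -⟩ := h1
  obtain ⟨hbc, hcb, hM, hM', hZ, hZ'⟩ := h2
  refine ⟨?_, ?_, ?_, ?_, hZ, hZ'⟩
  · calc a * c' * c = a * b' * (b * c' * c) := by
          rw [← mul_assoc, ← mul_assoc, hab]
      _ = a := by rw [hbc, hab]
  · calc c * c' * a = c * c' * b * (b' * a) := by
          rw [mul_assoc (c * c'), ← mul_assoc b, hba]
      _ = a := by rw [hcb, ← mul_assoc, hba]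
  · have key : a * c' = a * b' * (b * c') := by rw [← mul_assoc, hab]
    exact key ▸ h.nMul _ hN _ hM
  · have key : c' * a = c' * b * (b' * a) := by rw [mul_assoc c', ← mul_assoc b, hba]
    exact key ▸ h.nMul _ hM' _ hN'
end

section
/- In a structured semigroup (S, N, Z), the domination relation is multiplicative: for all a, b, b', c, d, d' ∈ S, if a <_{b'} b and c <_{d'} d then ac <_{d'b'} bd. -/
open Pointwise

variable {S : Type*}

theorem stmt6 [Semigroup S] (N Z : Set S) (h : Structured N Z) (a b b' c d d' : S)
    (h1 : domBy N Z a b' b) (h2 : domBy N Z c d' d) :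
    domBy N Z (a * c) (d' * b') (b * d) := by
  obtain ⟨k1, k2, k3, -, k5, k6⟩ := h2
  obtain ⟨h1, h2, -, h4, h5, h6⟩ := h1
  have e := h.zComm _ h6 _ k3
  have f := h.zComm _ k5 _ h4
  have hm := h.nMul _ h4 _ k3
  refine ⟨?_, ?_, ?_, ?_, ?_, ?_⟩
  · calc a * c * (d' * b') * (b * d) = a * ((c * d') * (b' * b)) * d := by simp only [mul_assoc]
      _ = (a * b' * b) * (c * d' * d) := by rw [← e]; simp only [mul_assoc]
      _ = a * c := by rw [h1, k1]
  · calc b * d * (d' * b') * (a * c) = b * ((d * d') * (b' * a)) * c := by simp only [mul_assoc]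
      _ = (b * b' * a) * (d * d' * c) := by rw [f]; simp only [mul_assoc]
      _ = a * c := by rw [h2, k2]
  · have key := h.trinormal b' b (b' * a * (c * d')) hm
      (calc b' * b * (b' * a * (c * d')) = b' * (b * b' * a) * (c * d') := by
              simp only [mul_assoc]
        _ = _ := by rw [h2])
      (calc b' * a * (c * d') * b' * b = b' * a * ((c * d') * (b' * b)) := by
              simp only [mul_assoc]
        _ = b' * (a * b' * b) * (c * d') := by rw [← e]; simp only [mul_assoc]
        _ = _ := by rw [h1])
      h6 h5
    have eq : b * (b' * a * (c * d')) * b' = a * c * (d' * b') := by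
      calc _ = (b * b' * a) * (c * (d' * b')) := by simp only [mul_assoc]
        _ = _ := by rw [h2, mul_assoc]
    rwa [eq] at key
  · have key := h.trinormal d d' (b' * a * (c * d')) hm
      (calc d * d' * (b' * a * (c * d')) = ((d * d') * (b' * a)) * (c * d') := by
              simp only [mul_assoc]
        _ = b' * a * ((d * d' * c) * d') := by rw [f]; simp only [mul_assoc]
        _ = _ := by rw [k2])
      (calc b' * a * (c * d') * d * d' = b' * a * ((c * d' * d) * d') := by
              simp only [mul_assoc]
        _ = _ := by rw [k1])
      k5 k6
    have eq : d' * (b' * a * (c * d')) * d = d' * b' * (a * c) := by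
      calc _ = d' * b' * (a * (c * d' * d)) := by simp only [mul_assoc]
        _ = _ := by rw [k1]
    rwa [eq] at key
  · simpa only [mul_assoc] using (h.binormal b b' h5 h6 _ k5).1
  · simpa only [mul_assoc] using (h.binormal d d' k5 k6 _ h6).2
end

section
/- In a structured semigroup (S, N, Z), domination splits over pairs whose products lie in Z: for all a, b, b', c, c' ∈ S with cc' ∈ Z and c'c ∈ Z, if acc' = a and a <_{b'} b then ac <_{c'b'} bc. -/
open Pointwise

variable {S : Type*}

theorem stmt7 [Semigroup S] (N Z : Set S) (h : Structured N Z) (a b b' c c' : S)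
    (hcc' : c * c' ∈ Z) (hc'c : c' * c ∈ Z)
    (ha : a * c * c' = a) (hab : domBy N Z a b' b) :
    domBy N Z (a * c) (c' * b') (b * c) := by
  obtain ⟨h1, h2, h3, h4, h5, h6⟩ := hab
  have hr : b' * a * c * c' = b' * a := by
    rw [mul_assoc b' a c, mul_assoc b' (a * c) c', ha]
  have hl : c * c' * (b' * a) = b' * a := by
    rw [h.zComm _ hcc' _ h4, ← mul_assoc, hr]
  refine ⟨?_, ?_, ?_, ?_, ?_, ?_⟩
  · calc a * c * (c' * b') * (b * c) = a * c * c' * b' * b * c := by simp only [mul_assoc]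
      _ = a * c := by rw [ha, h1]
  · calc b * c * (c' * b') * (a * c) = b * (c * c' * (b' * a)) * c := by simp only [mul_assoc]
      _ = a * c := by rw [hl, ← mul_assoc, h2]
  · rwa [← mul_assoc, ha]
  · simpa only [mul_assoc] using h.trinormal c c' (b' * a) h4 hl hr hcc' hc'c
  · simpa only [mul_assoc] using (h.binormal b b' h5 h6 _ hcc').1
  · simpa only [mul_assoc] using (h.binormal c c' hcc' hc'c _ h6).2
end

section
/- In a structured semigroup (S, N, Z), for any subset A ⊆ S: (i) A^{<*} ⊆ A^{*<}; (ii) A^{<<} ⊆ A^{**}; consequently (iii) if A is nonempty and A ⊆ A^<, then A^* is nonempty. -/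
open Pointwise

variable {S : Type*}

/-- If `a <_s b <_t c` then `a <_{sbt} c` and `sbt <_c t`. -/
theorem Structured.domBy_trans [Semigroup S] {N Z : Set S} (h : Structured N Z)
    {a b c s t : S} (hab : domBy N Z a s b) (hbc : domBy N Z b t c) :
    domBy N Z a (s * b * t) c ∧ domBy N Z (s * b * t) c t := by
  obtain ⟨asb, bsa, has, hsa, -, hsb⟩ := hab
  obtain ⟨btc, ctb, hbt, htb, hct, htc⟩ := hbc
  have hc : c * (s * b * t) ∈ Z := by
    simpa only [mul_assoc] using (h.binormal c t hct htc _ hsb).1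
  have hc' : s * b * t * c ∈ Z := by
    rwa [mul_assoc s b t, mul_assoc s, btc]
  have comm : s * b * (t * b) = t * b * (s * b) := h.zComm _ hsb _ htb
  have left : c * (s * b * t) * a = a := by
    calc c * (s * b * t) * a = c * (s * b * t) * (b * s * a) := by rw [bsa]
      _ = c * (s * b * (t * b)) * (s * a) := by simp only [mul_assoc]
      _ = c * t * b * s * (b * s * a) := by rw [comm]; simp only [mul_assoc]
      _ = a := by rw [bsa, ctb, bsa]
  refine ⟨⟨?_, left, ?_, ?_, hc, hc'⟩, ⟨?_, ?_, h.zSubN hc', h.zSubN hc, htc, hct⟩⟩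
  · calc a * (s * b * t) * c = a * s * (b * t * c) := by simp only [mul_assoc]
      _ = a := by rw [btc, asb]
  · simpa only [mul_assoc] using h.nMul _ has _ hbt
  · have := h.nMul _ (h.zSubN hsb) _ (h.nMul _ htb _ hsa)
    rwa [show t * b * (s * a) = t * a by rw [mul_assoc t, ← mul_assoc b, bsa],
      ← mul_assoc] at this
  · calc s * b * t * c * t = s * (b * t * c) * t := by simp only [mul_assoc]
      _ = s * b * t := by rw [btc]
  · calc t * c * (s * b * t) = t * c * (s * b) * t := by simp only [mul_assoc]
      _ = s * b * (t * c) * t := by rw [h.zComm _ htc _ (h.zSubN hsb)]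
      _ = s * (b * t * c) * t := by simp only [mul_assoc]
      _ = s * b * t := by rw [btc]

theorem stmt8 [Semigroup S] (N Z : Set S) (h : Structured N Z) (A : Set S) :
    dualSet N Z (upClo N Z A) ⊆ upClo N Z (dualSet N Z A) ∧
    upClo N Z (upClo N Z A) ⊆ dualSet N Z (dualSet N Z A) ∧
    (A.Nonempty → A ⊆ upClo N Z A → (dualSet N Z A).Nonempty) := by
  refine ⟨?_, ?_, ?_⟩
  · rintro t ⟨b, ⟨a, ha, s, hab⟩, c, hbc⟩
    obtain ⟨hac, hst⟩ := h.domBy_trans hab hbc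
    exact ⟨s * b * t, ⟨a, ha, c, hac⟩, c, hst⟩
  · rintro c ⟨b, ⟨a, ha, s, hab⟩, t, hbc⟩
    obtain ⟨hac, hst⟩ := h.domBy_trans hab hbc
    exact ⟨s * b * t, ⟨a, ha, c, hac⟩, t, hst⟩
  · rintro ⟨b, hb⟩ hA
    obtain ⟨a, ha, s, hab⟩ := hA hb
    exact ⟨s, a, ha, b, hab⟩
end

section
/- In a structured semigroup (S, N, Z), if A ⊆ S is an atlas then A^* is a coset and A^< is a coset, with A^< = A^{**} (and A ⊆ A^<). -/
open Pointwise

variable {S : Type*}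

section Domination

variable [Semigroup S] {N Z A : Set S}

theorem domBy.trans {a s b t c : S} (h : Structured N Z) (hab : domBy N Z a s b)
    (hbc : domBy N Z b t c) : domBy N Z a t c := by
  obtain ⟨h1, h2, h3, h4, -, -⟩ := hab
  obtain ⟨k1, k2, k3, k4, k5, k6⟩ := hbc
  have hat : a * t = (a * s) * (b * t) := by grind
  have hta : t * a = (t * b) * (s * a) := by grind
  have hcta : c * t * a = a := calc
    c * t * a = c * t * (b * s * a) := by rw [h2]
    _ = (c * t * b) * s * a := by simp only [mul_assoc]
    _ = a := by rw [k2, h2]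
  refine ⟨by grind, hcta, ?_, ?_, k5, k6⟩
  · rw [hat]; exact h.nMul _ h3 _ k3
  · rw [hta]; exact h.nMul _ k4 _ h4

theorem domBy.inverse {a s b : S} (hab : domBy N Z a s b) : domBy N Z (s * a * s) b s := by
  obtain ⟨h1, h2, h3, h4, h5, h6⟩ := hab
  have hl : s * a * s * b = s * a := by grind
  have hr : b * (s * a * s) = a * s := by grind
  exact ⟨by grind, by grind, by rwa [hl], by rwa [hr], h6, h5⟩

theorem domBy.inverse_mul {a s b u t : S} (h : Structured N Z) (hab : domBy N Z a s b)
    (hst : domBy N Z s u t) : domBy N Z a (s * u * s) (b * t * b) := by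
  obtain ⟨h1, h2, h3, h4, h5, h6⟩ := hab
  obtain ⟨k1, k2, k3, k4, k5, k6⟩ := hst
  have c1 := h.zComm _ h6 _ k3
  have c2 := h.zComm _ h5 _ k4
  have z1 := (h.binormal t u k5 k6 _ h5).1
  have z2 := (h.binormal t u k5 k6 _ h6).2
  have z3 := (h.binormal b s h5 h6 _ z1).1
  have z4 := (h.binormal b s h5 h6 _ z2).2
  have n1 := h.nMul _ h3 _ k4
  have n2 := h.nMul _ k3 _ h4
  have hl : a * (s * u * s) * (b * t * b) = a := calc
    _ = a * (s * u * (s * b)) * t * b := by simp only [mul_assoc]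
    _ = (a * s * b) * (s * u * t) * b := by rw [← c1]; simp only [mul_assoc]
    _ = a := by rw [h1, k1, h1]
  have hr : b * t * b * (s * u * s) * a = a := calc
    _ = b * t * (b * s * (u * s)) * a := by simp only [mul_assoc]
    _ = b * (t * u * s) * (b * s * a) := by rw [c2]; simp only [mul_assoc]
    _ = a := by rw [h2, k2, h2]
  refine ⟨hl, hr, ?_, ?_, ?_, ?_⟩ <;> simp only [← mul_assoc] at * <;> assumption

theorem domBy.of_inverse {a s b u t : S} (h : Structured N Z) (hab : domBy N Z a s b)
    (hst : domBy N Z s u t) : domBy N Z (a * (s * u * s) * a) t u := by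
  obtain ⟨h1, h2, h3, h4, h5, h6⟩ := hab
  obtain ⟨k1, k2, k3, k4, k5, k6⟩ := hst
  have c1 := h.zComm _ k6 _ h3
  have c2 := h.zComm _ k5 _ h4
  have l1 : a * s * u * t = a * s := by grind
  have l2 : u * t * (a * s) = a * s := by grind
  have l3 : t * u * (s * a) = s * a := by grind
  have l4 : s * a * t * u = s * a := by grind
  have n1 := h.trinormal u t _ h3 l2 (by grind) k6 k5
  have n2 := h.trinormal t u _ h4 l3 l4 k5 k6
  have e1 : a * t * u = a := calc
    a * t * u = b * s * a * t * u := by rw [h2]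
    _ = b * (s * a * t * u) := by simp only [mul_assoc]
    _ = a := by rw [l4, ← mul_assoc, h2]
  have e2 : u * t * a = a := calc
    u * t * a = u * t * (a * s * b) := by rw [h1]
    _ = u * t * (a * s) * b := by simp only [mul_assoc]
    _ = a := by rw [l2, h1]
  have m1 := h.nMul _ h3 _ n2
  have m2 := h.nMul _ n1 _ h4
  refine ⟨by grind, by grind, ?_, ?_, k6, k5⟩ <;> simp only [← mul_assoc] at * <;> grind

theorem domBy.sandwich {a' x a s b : S} (h : Structured N Z) (ha : domBy N Z a' x a)
    (hab : domBy N Z a s b) : domBy N Z a' (s * a * s) (b * x * b) := by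
  obtain ⟨j1, j2, j3, j4, -, -⟩ := ha.trans h hab
  obtain ⟨h1, h2, h3, h4, h5, h6⟩ := hab
  obtain ⟨k1, k2, k3, k4, k5, k6⟩ := ha
  have c1 := h.zComm _ k5 _ j3
  have c2 := h.zComm _ k6 _ j4
  have z1 := (h.binormal b s h5 h6 _ k6).1
  have z2 := (h.binormal b s h5 h6 _ k5).2
  have n1 := h.nMul _ j3 _ h3
  have n2 := h.nMul _ h4 _ j4
  refine ⟨by grind, by grind, ?_, ?_, ?_, ?_⟩ <;> simp only [← mul_assoc] at * <;> grind

theorem domBy.triple {a s b e r c f t d : S} (h : Structured N Z) (hs : domBy N Z a s b)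
    (hc : domBy N Z e r c) (ht : domBy N Z f t d) :
    domBy N Z (f * r * (e * r * a)) (s * c * t) (d * r * b) := by
  obtain ⟨h1, h2, h3, h4, h5, h6⟩ := hs
  obtain ⟨k1, k2, k3, k4, k5, k6⟩ := hc
  obtain ⟨l1, l2, l3, l4, l5, l6⟩ := ht
  have z1 := (h.binormal c r k5 k6 _ l6).1
  have z2 := (h.binormal c r k5 k6 _ h5).2
  have z3 := (h.binormal s b h6 h5 _ z1).1
  have z4 := (h.binormal t d l6 l5 _ z2).2
  have n1 := h.nMul _ k3 _ h3
  have n2 := h.nMul _ l4 _ k4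
  have c1 := h.zComm _ k5 _ n1
  have c2 := h.zComm _ k6 _ n2
  have x1 : c * r * (e * r * (a * s)) = e * r * (a * s) := by
    simp only [← mul_assoc, k2]
  have x2 : t * f * (r * e) * (r * c) = t * f * (r * e) := calc
    _ = t * f * r * (e * r * c) := by simp only [mul_assoc]
    _ = _ := by rw [k1]; simp only [mul_assoc]
  have m1 := h.trinormal c r _ n1 x1 (by rw [mul_assoc, ← c1, x1]) k5 k6
  have m2 := h.trinormal r c _ n2 (by rw [c2, x2]) (by rw [mul_assoc, x2]) k6 k5
  have p1 := h.nMul _ l4 _ m1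
  have p2 := h.nMul _ m2 _ h3
  have d1 := h.zComm _ l6 _ p1
  have d2 := h.zComm _ h5 _ p2
  have y1 (w : S) : t * d * (t * f * w) = t * f * w := calc
    _ = t * (d * t * f) * w := by simp only [mul_assoc]
    _ = _ := by rw [l2]
  have y2 (w : S) : w * (a * s) * (b * s) = w * (a * s) := calc
    _ = w * (a * s * b) * s := by simp only [mul_assoc]
    _ = _ := by rw [h1]; simp only [mul_assoc]
  have q1 := h.trinormal t d _ p1 (y1 _) (by rw [mul_assoc, ← d1, y1]) l6 l5
  have q2 := h.trinormal b s _ p2 (by rw [d2, y2]) (by rw [mul_assoc, y2]) h5 h6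
  have e1 := h.zComm _ z1 _ h3
  have e2 := h.zComm _ l6 _ k4
  have e3 := h.zComm _ z2 _ l4
  have e4 := h.zComm _ h5 _ k3
  refine ⟨?_, ?_, ?_, ?_, ?_, ?_⟩
  · calc _ = f * r * e * r * (a * s * (c * (t * d) * r)) * b := by simp only [mul_assoc]
      _ = f * r * (e * r * c) * (t * d) * r * (a * s * b) := by
        rw [← e1]; simp only [mul_assoc]
      _ = f * (r * e * (t * d)) * r * a := by rw [k1, h1]; simp only [mul_assoc]
      _ = (f * t * d) * r * e * r * a := by rw [← e2]; simp only [mul_assoc]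
      _ = _ := by rw [l1]; simp only [mul_assoc]
  · calc _ = d * (r * (b * s) * c * (t * f)) * r * e * r * a := by simp only [mul_assoc]
      _ = (d * t * f) * r * (b * s) * (c * r * e) * r * a := by
        rw [e3]; simp only [mul_assoc]
      _ = f * r * (b * s * (e * r)) * a := by rw [k2, l2]; simp only [mul_assoc]
      _ = f * r * e * r * (b * s * a) := by rw [e4]; simp only [mul_assoc]
      _ = _ := by rw [h2]; simp only [mul_assoc]
  · convert q1 using 1
    conv_lhs => rw [← l2]
    simp only [mul_assoc]
  · convert q2 using 1
    conv_lhs => rw [← h1]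
    simp only [mul_assoc]
  · convert z4 using 1; simp only [mul_assoc]
  · convert z3 using 1; simp only [mul_assoc]

end Domination

section Atlas

variable [Semigroup S] {N Z A : Set S}

theorem IsAtlas.mul_mem (hA : IsAtlas N Z A) {a s b : S} (ha : a ∈ A)
    (hs : s ∈ dualSet N Z A) (hb : b ∈ A) : a * s * b ∈ A :=
  hA.1 (Set.mul_mem_mul (Set.mul_mem_mul ha hs) hb)

theorem IsAtlas.inverse_mem_dualSet (h : Structured N Z) (hA : IsAtlas N Z A) {a s b : S}
    (ha : a ∈ A) (hab : domBy N Z a s b) : s * a * s ∈ dualSet N Z A := by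
  obtain ⟨a', ha', x, hx⟩ := hA.2 ha
  exact ⟨a', ha', _, hx.sandwich h hab⟩

theorem IsAtlas.exists_domBy (h : Structured N Z) (hA : IsAtlas N Z A) {s u t : S}
    (hs : s ∈ dualSet N Z A) (hst : domBy N Z s u t) : ∃ a ∈ A, domBy N Z a t u := by
  obtain ⟨a, ha, b, hab⟩ := hs
  exact ⟨_, hA.mul_mem ha ⟨a, ha, _, hab.inverse_mul h hst⟩ ha, hab.of_inverse h hst⟩

theorem IsAtlas.upClo_eq_dualSet_dualSet (h : Structured N Z) (hA : IsAtlas N Z A) :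
    upClo N Z A = dualSet N Z (dualSet N Z A) := by
  ext c
  constructor
  · rintro ⟨a, ha, s, hs⟩
    exact ⟨_, hA.inverse_mem_dualSet h ha hs, s, hs.inverse⟩
  · rintro ⟨s, hs, d, hd⟩
    obtain ⟨a, ha, had⟩ := hA.exists_domBy h hs hd
    exact ⟨a, ha, d, had⟩

theorem IsAtlas.upClo_dualSet (h : Structured N Z) (hA : IsAtlas N Z A) :
    upClo N Z (dualSet N Z A) = dualSet N Z A := by
  ext t
  constructor
  · rintro ⟨s, hs, u, hu⟩
    obtain ⟨a, ha, hau⟩ := hA.exists_domBy h hs hu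
    exact ⟨a, ha, u, hau⟩
  · rintro ⟨a, ha, b, hab⟩
    exact ⟨_, hA.inverse_mem_dualSet h ha hab, b, hab.inverse⟩

theorem IsAtlas.isCoset_dualSet (h : Structured N Z) (hA : IsAtlas N Z A) :
    IsCoset N Z (dualSet N Z A) := by
  refine ⟨?_, hA.upClo_dualSet h⟩
  rw [← hA.upClo_eq_dualSet_dualSet h]
  rintro _ ⟨_, ⟨s, ⟨a, ha, b, hs⟩, c, ⟨e, he, r, hr⟩, rfl⟩, t, ⟨f, hf, d, ht⟩, rfl⟩
  have hrA : r ∈ dualSet N Z A := ⟨e, he, c, hr⟩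
  exact ⟨_, hA.mul_mem hf hrA (hA.mul_mem he hrA ha), _, hs.triple h hr ht⟩

theorem IsCoset.isAtlas (hA : IsCoset N Z A) : IsAtlas N Z A :=
  ⟨hA.1, hA.2.ge⟩

end Atlas

theorem stmt11 [Semigroup S] (N Z : Set S) (h : Structured N Z) (A : Set S)
    (hA : IsAtlas N Z A) :
    IsCoset N Z (dualSet N Z A) ∧
    IsCoset N Z (upClo N Z A) ∧
    upClo N Z A = dualSet N Z (dualSet N Z A) ∧
    A ⊆ upClo N Z A := by
  have hdual := hA.isCoset_dualSet h
  have hup := hA.upClo_eq_dualSet_dualSet h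
  exact ⟨hdual, hup ▸ hdual.isAtlas.isCoset_dualSet h, hup, hA.2⟩
end

section
/- In a structured semigroup (S, N, Z), for every a ∈ S the family C_a = {C : C is a nonempty coset and a ∈ C} is a slice of the coset groupoid: if B and C are nonempty cosets with a ∈ B and a ∈ C, and either s(B) = s(C) or r(B) = r(C), then B = C. -/
open Pointwise

variable {S : Type*}

/-- Domination is compatible with products. -/
theorem domBy.mul [Semigroup S] {N Z : Set S} (h : Structured N Z) {a s b a' s' b' : S}
    (h₁ : domBy N Z a s b) (h₂ : domBy N Z a' s' b') :
    domBy N Z (a * a') (s' * s) (b * b') := by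
  obtain ⟨e₁, e₂, n₁, n₂, z₁, z₂⟩ := h₁
  obtain ⟨e₁', e₂', n₁', n₂', z₁', z₂'⟩ := h₂
  have hn := h.nMul _ n₂ _ n₁'
  have hcomm : s * b * (a' * s') = a' * s' * (s * b) := h.zComm _ z₂ _ n₁'
  have hcomm' : b' * s' * (s * a) = s * a * (b' * s') := h.zComm _ z₁' _ n₂
  refine ⟨?_, ?_, ?_, ?_, ?_, ?_⟩
  · calc a * a' * (s' * s) * (b * b') = a * (a' * s' * (s * b)) * b' := by simp only [mul_assoc]
      _ = (a * s * b) * (a' * s' * b') := by rw [← hcomm]; simp only [mul_assoc]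
      _ = a * a' := by rw [e₁, e₁']
  · calc b * b' * (s' * s) * (a * a') = b * (b' * s' * (s * a)) * a' := by simp only [mul_assoc]
      _ = (b * s * a) * (b' * s' * a') := by rw [hcomm']; simp only [mul_assoc]
      _ = a * a' := by rw [e₂, e₂']
  · have key := h.trinormal s b (s * a * (a' * s')) hn
      (by
        calc s * b * (s * a * (a' * s')) = s * (b * s * a) * (a' * s') := by simp only [mul_assoc]
          _ = _ := by rw [e₂])
      (by
        calc s * a * (a' * s') * s * b = s * a * (a' * s' * (s * b)) := by simp only [mul_assoc]
          _ = s * (a * s * b) * (a' * s') := by rw [← hcomm]; simp only [mul_assoc]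
          _ = _ := by rw [e₁])
      z₂ z₁
    have : b * (s * a * (a' * s')) * s = a * a' * (s' * s) := by
      calc _ = (b * s * a) * (a' * (s' * s)) := by simp only [mul_assoc]
        _ = _ := by rw [e₂, mul_assoc]
    rwa [this] at key
  · have key := h.trinormal b' s' (s * a * (a' * s')) hn
      (by
        calc b' * s' * (s * a * (a' * s')) = b' * s' * (s * a) * (a' * s') := by
              simp only [mul_assoc]
          _ = s * a * (b' * s' * a' * s') := by rw [hcomm']; simp only [mul_assoc]
          _ = _ := by rw [e₂'])
      (by
        calc s * a * (a' * s') * b' * s' = s * a * ((a' * s' * b') * s') := by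
              simp only [mul_assoc]
          _ = _ := by rw [e₁'])
      z₁' z₂'
    have : s' * (s * a * (a' * s')) * b' = s' * s * (a * a') := by
      calc _ = s' * s * a * (a' * s' * b') := by simp only [mul_assoc]
        _ = _ := by rw [e₁']; simp only [mul_assoc]
    rwa [this] at key
  · have := (h.binormal b s z₁ z₂ _ z₁').1
    simpa only [mul_assoc] using this
  · have := (h.binormal b' s' z₁' z₂' _ z₂).2
    simpa only [mul_assoc] using this

theorem domRel.mul [Semigroup S] {N Z : Set S} (h : Structured N Z) {a b a' b' : S}
    (h₁ : domRel N Z a b) (h₂ : domRel N Z a' b') : domRel N Z (a * a') (b * b') := by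
  obtain ⟨s, hs⟩ := h₁
  obtain ⟨s', hs'⟩ := h₂
  exact ⟨_, hs.mul h hs'⟩

/-- Multiplying the dominated element by an element of `Z` on the left preserves domination. -/
theorem domBy.left_mul [Semigroup S] {N Z : Set S} (h : Structured N Z) {a s b z : S}
    (h₁ : domBy N Z a s b) (hz : z ∈ Z) : domBy N Z (z * a) s b := by
  obtain ⟨e₁, e₂, n₁, n₂, z₁, z₂⟩ := h₁
  have hcomm : b * s * z = z * (b * s) := h.zComm _ z₁ _ (h.zSubN hz)
  have hn : z * (a * s) ∈ N := h.nMul _ (h.zSubN hz) _ n₁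
  refine ⟨by rw [mul_assoc, mul_assoc, ← mul_assoc a, e₁], ?_, by rwa [mul_assoc], ?_, z₁, z₂⟩
  · calc b * s * (z * a) = b * s * z * a := by simp only [mul_assoc]
      _ = z * (b * s * a) := by rw [hcomm, mul_assoc]
      _ = _ := by rw [e₂]
  · have key := h.trinormal b s (z * (a * s)) hn
      (by
        calc b * s * (z * (a * s)) = b * s * z * (a * s) := by simp only [mul_assoc]
          _ = z * (b * s * a * s) := by rw [hcomm]; simp only [mul_assoc]
          _ = _ := by rw [e₂])
      (by
        calc z * (a * s) * b * s = z * (a * s * b * s) := by simp only [mul_assoc]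
          _ = _ := by rw [e₁])
      z₁ z₂
    have : s * (z * (a * s)) * b = s * (z * a) := by
      calc _ = s * (z * (a * s * b)) := by simp only [mul_assoc]
        _ = _ := by rw [e₁]
    rwa [this] at key

/-- Multiplying the dominated element by an element of `Z` on the right preserves domination. -/
theorem domBy.mul_right [Semigroup S] {N Z : Set S} (h : Structured N Z) {a s b z : S}
    (h₁ : domBy N Z a s b) (hz : z ∈ Z) : domBy N Z (a * z) s b := by
  obtain ⟨e₁, e₂, n₁, n₂, z₁, z₂⟩ := h₁
  have hcomm : s * b * z = z * (s * b) := h.zComm _ z₂ _ (h.zSubN hz)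
  have hn : s * a * z ∈ N := h.nMul _ n₂ _ (h.zSubN hz)
  refine ⟨?_, by rw [← mul_assoc, e₂], ?_, by rwa [← mul_assoc], z₁, z₂⟩
  · calc a * z * s * b = a * (z * (s * b)) := by simp only [mul_assoc]
      _ = a * s * b * z := by rw [← hcomm]; simp only [mul_assoc]
      _ = _ := by rw [e₁]
  · have key := h.trinormal s b (s * a * z) hn
      (by
        calc s * b * (s * a * z) = s * (b * s * a) * z := by simp only [mul_assoc]
          _ = _ := by rw [e₂])
      (by
        calc s * a * z * s * b = s * a * (z * (s * b)) := by simp only [mul_assoc]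
          _ = s * (a * s * b) * z := by rw [← hcomm]; simp only [mul_assoc]
          _ = _ := by rw [e₁])
      z₂ z₁
    have : b * (s * a * z) * s = a * z * s := by
      calc _ = b * s * a * z * s := by simp only [mul_assoc]
        _ = _ := by rw [e₂]
    rwa [this] at key

/-- The dual of an atlas is contained in its own up-closure. -/
theorem dualSet_subset_upClo [Semigroup S] {N Z : Set S} (h : Structured N Z) {A : Set S}
    (hA : A ⊆ upClo N Z A) : dualSet N Z A ⊆ upClo N Z (dualSet N Z A) := by
  rintro s ⟨x, hx, y, e₁, e₂, n₁, n₂, z₁, z₂⟩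
  obtain ⟨x', hx', t, e₁', e₂', n₁', n₂', z₁', z₂'⟩ := hA hx
  have ey : x' * s = x' * t * (x * s) := by
    calc x' * s = x' * t * x * s := by rw [e₁']
      _ = _ := by simp only [mul_assoc]
  have es : s * x' = s * x * (t * x') := by
    calc s * x' = s * (x * t * x') := by rw [e₂']
      _ = _ := by simp only [mul_assoc]
  have hcomm : t * x * (s * x) = s * x * (t * x) := h.zComm _ z₂' _ n₂
  have hcomm' : t * x * (s * y) = s * y * (t * x) := h.zComm _ z₂' _ (h.zSubN z₂)
  have eu : t * x * s * x' = s * x' := by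
    calc t * x * s * x' = t * x * (s * x') := by simp only [mul_assoc]
      _ = t * x * (s * x) * (t * x') := by rw [es]; simp only [mul_assoc]
      _ = s * x * (t * (x * t * x')) := by rw [hcomm]; simp only [mul_assoc]
      _ = _ := by rw [e₂', ← es]
  have euy : t * x * s * y = t * x := by
    calc _ = t * (x * s * y) := by simp only [mul_assoc]
      _ = _ := by rw [e₁]
  have hyu : y * (t * x * s) ∈ Z := by
    have := (h.binormal y s z₁ z₂ _ z₂').1
    rwa [mul_assoc] at this
  have eyx : y * s * x' = x' := by
    calc y * s * x' = y * s * (x * t * x') := by rw [e₂']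
      _ = y * s * x * t * x' := by simp only [mul_assoc]
      _ = _ := by rw [e₂, e₂']
  refine ⟨t * x * s, ⟨x', hx', y, ?_, ?_, ?_, ?_, hyu, ?_⟩, y, ?_, ?_, ?_, ?_, z₂, z₁⟩
  · calc x' * (t * x * s) * y = x' * (t * x * s * y) := by simp only [mul_assoc]
      _ = x' * t * x := by rw [euy, mul_assoc]
      _ = x' := e₁'
  · rw [mul_assoc, eu, ← mul_assoc, eyx]
  · have := h.nMul _ n₁' _ n₁
    simpa only [mul_assoc] using this
  · rw [eu, es]
    exact h.nMul _ n₂ _ n₂'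
  · rwa [euy]
  · rw [euy]
  · calc s * y * (t * x * s) = s * y * (t * x) * s := by simp only [mul_assoc]
      _ = t * x * s * y * s := by rw [← hcomm']; simp only [mul_assoc]
      _ = _ := by rw [euy]
  · rw [euy]
    exact h.zSubN z₂'
  · exact h.zSubN hyu

theorem mul_mem_upClo [Semigroup S] {N Z : Set S} (h : Structured N Z) {A B : Set S} {a b : S}
    (ha : a ∈ upClo N Z A) (hb : b ∈ upClo N Z B) : a * b ∈ upClo N Z (A * B) := by
  obtain ⟨a', ha', da⟩ := ha
  obtain ⟨b', hb', db⟩ := hb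
  exact ⟨a' * b', Set.mul_mem_mul ha' hb', da.mul h db⟩

/-- Two cosets with a common element are comparable as soon as their sources or their ranges
are. -/
theorem IsCoset.subset_of_mem [Semigroup S] {N Z : Set S} (h : Structured N Z) {a : S}
    {B C : Set S} (hB : IsCoset N Z B) (hC : IsCoset N Z C) (haB : a ∈ B) (haC : a ∈ C)
    (hsr : srcSet N Z C ⊆ srcSet N Z B ∨ rngSet N Z C ⊆ rngSet N Z B) : C ⊆ B := by
  intro c hc
  have hCs := dualSet_subset_upClo h hC.2.ge
  obtain ⟨c', hc', r, hr⟩ := hC.2.ge hc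
  obtain ⟨d, hd, s, hs⟩ := hC.2.ge haC
  obtain ⟨a', ha', da⟩ := hB.2.ge haB
  have hsC : s ∈ dualSet N Z C := ⟨d, hd, a, hs⟩
  rcases hsr with hsrc | hrng
  · obtain ⟨p, ⟨t, ht, b, hb, rfl⟩, hp⟩ := hsrc (mul_mem_upClo h (hCs hsC) (hC.2.ge hc'))
    have hmem : a' * (t * b) ∈ B := by
      rw [← mul_assoc]
      exact hB.1 (Set.mul_mem_mul (Set.mul_mem_mul ha' ht) hb)
    have hmem' : a * s * c' ∈ B := by
      rw [mul_assoc, ← hB.2]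
      exact ⟨_, hmem, da.mul h hp⟩
    rw [← hB.2]
    exact ⟨_, hmem', r, hr.left_mul h hs.2.2.2.2.1⟩
  · obtain ⟨p, ⟨b, hb, t, ht, rfl⟩, hp⟩ := hrng (mul_mem_upClo h (hC.2.ge hc') (hCs hsC))
    have hmem : b * t * a' ∈ B := hB.1 (Set.mul_mem_mul (Set.mul_mem_mul hb ht) ha')
    have hmem' : c' * (s * a) ∈ B := by
      rw [← mul_assoc, ← hB.2]
      exact ⟨_, hmem, domRel.mul h hp da⟩
    rw [← hB.2]
    exact ⟨_, hmem', r, hr.mul_right h hs.2.2.2.2.2⟩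

theorem stmt15 [Semigroup S] (N Z : Set S) (h : Structured N Z) (a : S) (B C : Set S)
    (hB : IsCoset N Z B) (hBne : B.Nonempty)
    (hC : IsCoset N Z C) (hCne : C.Nonempty)
    (haB : a ∈ B) (haC : a ∈ C)
    (hsr : srcSet N Z B = srcSet N Z C ∨ rngSet N Z B = rngSet N Z C) :
    B = C := by
  exact (hC.subset_of_mem h hB haC haB (hsr.imp Eq.le Eq.le)).antisymm
    (hB.subset_of_mem h hC haB haC (hsr.imp Eq.ge Eq.ge))
end

section
/- In a structured semigroup (S, N, Z), if Z is symmetric then for all a, b, b', n ∈ S with n ∈ N: (i) a <_{b'} nb implies a <_{b'nbb'n} b; and (ii) if moreover N is diagonal, then a <_{b'n} b implies a <_{b'nbb'n} b. -/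
open Pointwise

variable {S : Type*}

theorem stmt16 [Semigroup S] (N Z : Set S) (h : Structured N Z) (hsym : IsSymmetric Z)
    (a b b' n : S) (hn : n ∈ N) :
    (domBy N Z a b' (n * b) → domBy N Z a (b' * n * b * b' * n) b) ∧
    (IsDiagonal N → domBy N Z a (b' * n) b → domBy N Z a (b' * n * b * b' * n) b) := by
  constructor
  · rintro ⟨ha, ha', hN, -, hz, hz'⟩
    set z := n * b * b' with hzdef
    set w := b * b' * n * (b * b') * n with hwdef
    have hw : w ∈ Z := by
      have := hsym n (b * b') (by simpa only [hzdef, mul_assoc] using hz)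
      simpa only [hwdef, mul_assoc] using this
    have hzn : z * n = n * z := h.zComm z hz n hn
    have hwac : w * (a * b') = a * b' * w := h.zComm w hw _ hN
    have hwn : w * n = n * w := h.zComm w hw n hn
    have hsa : b' * n * b * b' * n * a = b' * (n * (a * b')) * (n * b) :=
      calc b' * n * b * b' * n * a = b' * (z * n) * a := by simp only [hzdef, mul_assoc]
        _ = b' * n * (z * a) := by rw [hzn]; simp only [mul_assoc]
        _ = b' * n * (a * b' * (n * b)) := by rw [ha', ha]
        _ = _ := by simp only [mul_assoc]
    refine ⟨?_, ?_, ?_, ?_, ?_, ?_⟩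
    · calc a * (b' * n * b * b' * n) * b = a * b' * (n * b) * b' * (n * b) := by
            simp only [mul_assoc]
        _ = a := by rw [ha, ha]
    · calc b * (b' * n * b * b' * n) * a = w * a := by simp only [hwdef, mul_assoc]
        _ = w * (a * b') * (n * b) := by
            conv_lhs => rw [← ha]
            simp only [mul_assoc]
        _ = a * b' * (w * n) * b := by rw [hwac]; simp only [mul_assoc]
        _ = a * b' * (n * b) * b' * (n * b) * b' * (n * b) := by
            rw [hwn]; simp only [hwdef, mul_assoc]
        _ = a := by rw [ha, ha, ha]
    · have := h.nMul _ (h.nMul _ hN _ (h.zSubN hz)) _ hn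
      simpa only [hzdef, mul_assoc] using this
    · rw [hsa]
      refine h.trinormal (n * b) b' _ (h.nMul _ hn _ hN) ?_ ?_ hz hz'
      · calc z * (n * (a * b')) = z * n * a * b' := by simp only [mul_assoc]
          _ = n * (z * a) * b' := by rw [hzn]; simp only [mul_assoc]
          _ = n * (a * b') := by rw [ha']; simp only [mul_assoc]
      · calc n * (a * b') * (n * b) * b' = n * (a * b' * (n * b)) * b' := by
              simp only [mul_assoc]
          _ = n * (a * b') := by rw [ha]; simp only [mul_assoc]
    · simpa only [hwdef, mul_assoc] using hw
    · simpa only [mul_assoc] using h.zMul _ hz' _ hz'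
  · rintro - ⟨ha, ha', hN, hN', hz, hz'⟩
    refine ⟨?_, ?_, ?_, ?_, ?_, ?_⟩
    · calc a * (b' * n * b * b' * n) * b = a * (b' * n) * b * (b' * n) * b := by
            simp only [mul_assoc]
        _ = a := by rw [ha, ha]
    · calc b * (b' * n * b * b' * n) * a = b * (b' * n) * (b * (b' * n) * a) := by
            simp only [mul_assoc]
        _ = a := by rw [ha', ha']
    · simpa only [mul_assoc] using h.nMul _ hN _ (h.zSubN hz)
    · simpa only [mul_assoc] using h.nMul _ (h.zSubN hz') _ hN'
    · simpa only [mul_assoc] using h.zMul _ hz _ hz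
    · simpa only [mul_assoc] using h.zMul _ hz' _ hz'
end
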